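/- arXiv:1301.2492 — 2 statements merged into one kernel-verified Lean document; each statement's English description precedes it below -/
import Mathlib

section
/- Commutation relations of the canonical frame for a real Jordan block. Let U ⊆ ℝ^n be open, let e_1, …, e_n : U → ℝ^n be smooth vector fields that are linearly independent at every point, let ε ∈ {+1, −1}, and let λ : U → ℝ be smooth with λ(x) ≠ 0 for all x. Define g : U → Mat_n(ℝ) as the unique map with g(x) symmetric and e_i(x)ᵀ g(x) e_j(x) = ε if i + j = n + 1 and = 0 otherwise, and define L : U → Mat_n(ℝ) as the unique map with L(x) e_j(x) = λ(x) e_j(x) + e_{j−1}(x) for all j (with the convention e_0 := 0). If L is compatible with g on U, then: (a) [e_i, e_j] = 0 for all i, j ≤ n−1, and (b) [e_i, e_n] = −i·e_n(λ)·e_{i+1} for i = 1, …, n−1, where e_n(λ) = Dλ·e_n. -/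
open Matrix Polynomial

noncomputable def pd {ι : Type*} [Fintype ι] [DecidableEq ι] (i : ι)
    (f : (ι → ℝ) → ℝ) (x : ι → ℝ) : ℝ :=
  fderiv ℝ f x (Pi.single i 1)

noncomputable def christoffel {ι : Type*} [Fintype ι] [DecidableEq ι]
    (g : (ι → ℝ) → Matrix ι ι ℝ) (x : ι → ℝ) (l j k : ι) : ℝ :=
  (1/2) * ∑ m, (g x)⁻¹ l m *
    (pd j (fun y => g y m k) x + pd k (fun y => g y m j) x - pd m (fun y => g y j k) x)

def IsCompatiblePair {ι : Type*} [Fintype ι] [DecidableEq ι]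
    (U : Set (ι → ℝ)) (g L : (ι → ℝ) → Matrix ι ι ℝ) : Prop :=
  (∀ i j : ι, ContDiffOn ℝ (⊤ : ℕ∞) (fun y => g y i j) U) ∧
  (∀ i j : ι, ContDiffOn ℝ (⊤ : ℕ∞) (fun y => L y i j) U) ∧
  (∀ x ∈ U, (g x).IsSymm ∧ IsUnit (g x).det ∧ IsUnit (L x).det ∧ (g x * L x).IsSymm) ∧
  (∀ x ∈ U, ∀ i j k : ι,
    pd k (fun y => (g y * L y) i j) x
      - (∑ l, christoffel g x l k i * (g x * L x) l j)
      - (∑ l, christoffel g x l k j * (g x * L x) i l)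
    = pd i (fun y => (1/2) * (L y).trace) x * g x j k
      + pd j (fun y => (1/2) * (L y).trace) x * g x i k)

section helpers
variable {ι : Type*} [Fintype ι] [DecidableEq ι]

lemma fderiv_eq_sum_pd (f : (ι → ℝ) → ℝ) (x u : ι → ℝ) :
    fderiv ℝ f x u = ∑ k, u k * pd k f x := by
  have hu : u = ∑ k, u k • (Pi.single k (1:ℝ) : ι → ℝ) := by
    ext c
    simp [Finset.sum_apply, Pi.single_apply]
  conv_lhs => rw [hu]
  simp [map_sum, pd]

noncomputable def conn (g : (ι → ℝ) → Matrix ι ι ℝ) (x u : ι → ℝ) : Matrix ι ι ℝ :=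
  fun c l => ∑ k, christoffel g x c k l * u k

noncomputable def dvec (b : (ι → ℝ) → ι → ℝ) (x u : ι → ℝ) : ι → ℝ :=
  fun c => fderiv ℝ (fun y => b y c) x u

noncomputable def cov (g : (ι → ℝ) → Matrix ι ι ℝ) (x u : ι → ℝ)
    (b : (ι → ℝ) → ι → ℝ) : ι → ℝ :=
  dvec b x u + conn g x u *ᵥ b x

lemma fderiv_bilin (M : (ι → ℝ) → Matrix ι ι ℝ) (a b : (ι → ℝ) → ι → ℝ) (x u : ι → ℝ)
    (hM : ∀ i j, DifferentiableAt ℝ (fun y => M y i j) x)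
    (ha : ∀ i, DifferentiableAt ℝ (fun y => a y i) x)
    (hb : ∀ i, DifferentiableAt ℝ (fun y => b y i) x) :
    fderiv ℝ (fun y => a y ⬝ᵥ M y *ᵥ b y) x u =
      dvec a x u ⬝ᵥ M x *ᵥ b x
      + a x ⬝ᵥ (Matrix.of fun i j => fderiv ℝ (fun y => M y i j) x u) *ᵥ b x
      + a x ⬝ᵥ M x *ᵥ dvec b x u := by
  have h : HasFDerivAt (fun y => ∑ i, a y i * ∑ j, M y i j * b y j)
      (∑ i, (a x i • (∑ j, (M x i j • fderiv ℝ (fun y => b y j) x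
        + b x j • fderiv ℝ (fun y => M y i j) x))
        + (∑ j, M x i j * b x j) • fderiv ℝ (fun y => a y i) x)) x := by
    refine HasFDerivAt.fun_sum fun i _ => ?_
    refine HasFDerivAt.mul (ha i).hasFDerivAt ?_
    refine HasFDerivAt.fun_sum fun j _ => ?_
    exact HasFDerivAt.mul (hM i j).hasFDerivAt (hb j).hasFDerivAt
  have h2 := h.fderiv
  have h3 : (fun y => a y ⬝ᵥ M y *ᵥ b y) = (fun y => ∑ i, a y i * ∑ j, M y i j * b y j) := by
    ext y; simp [dotProduct, mulVec]
  rw [h3, h2]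
  simp only [dotProduct, mulVec, dvec, Matrix.of_apply, _root_.sum_apply,
    _root_.add_apply, _root_.smul_apply, smul_eq_mul,
    ← Finset.sum_add_distrib]
  refine Finset.sum_congr rfl fun i _ => ?_
  rw [Finset.sum_add_distrib, mul_add]
  simp only [mul_comm (b x _)]
  ring

lemma leibniz (g M : (ι → ℝ) → Matrix ι ι ℝ) (a b : (ι → ℝ) → ι → ℝ) (x u : ι → ℝ)
    (T : ι → ι → ι → ℝ)
    (hM : ∀ i j, DifferentiableAt ℝ (fun y => M y i j) x)
    (ha : ∀ i, DifferentiableAt ℝ (fun y => a y i) x)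
    (hb : ∀ i, DifferentiableAt ℝ (fun y => b y i) x)
    (hT : ∀ i j k, pd k (fun y => M y i j) x
      - (∑ l, christoffel g x l k i * M x l j)
      - (∑ l, christoffel g x l k j * M x i l) = T i j k) :
    fderiv ℝ (fun y => a y ⬝ᵥ M y *ᵥ b y) x u =
      cov g x u a ⬝ᵥ M x *ᵥ b x + a x ⬝ᵥ M x *ᵥ cov g x u b
      + ∑ i, ∑ j, ∑ k, T i j k * a x i * b x j * u k := by
  rw [fderiv_bilin M a b x u hM ha hb]
  have hM' : (Matrix.of fun i j => fderiv ℝ (fun y => M y i j) x u)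
      = (conn g x u)ᵀ * M x + M x * conn g x u + Matrix.of fun i j => ∑ k, T i j k * u k := by
    ext i j
    simp only [Matrix.of_apply, Matrix.add_apply, Matrix.mul_apply, Matrix.transpose_apply, conn,
      fderiv_eq_sum_pd, Finset.sum_mul, Finset.mul_sum]
    rw [Finset.sum_comm, Finset.sum_comm (f := fun l k => M x i l * _),
      ← Finset.sum_add_distrib, ← Finset.sum_add_distrib]
    refine Finset.sum_congr rfl fun k _ => ?_
    rw [← hT i j k, sub_mul, sub_mul, Finset.sum_mul, Finset.sum_mul]
    have e1 : ∀ l, christoffel g x l k i * u k * M x l j = christoffel g x l k i * M x l j * u k :=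
      fun l => by ring
    have e2 : ∀ l, M x i l * (christoffel g x l k j * u k)
      = christoffel g x l k j * M x i l * u k := fun l => by ring
    simp only [e1, e2]
    ring
  rw [hM']
  have h3 : a x ⬝ᵥ (Matrix.of fun i j => ∑ k, T i j k * u k) *ᵥ b x
      = ∑ i, ∑ j, ∑ k, T i j k * a x i * b x j * u k := by
    simp only [dotProduct, mulVec, Matrix.of_apply, Finset.sum_mul, Finset.mul_sum]
    refine Finset.sum_congr rfl fun i _ => Finset.sum_congr rfl fun j _ =>
      Finset.sum_congr rfl fun k _ => by ring
  rw [← h3]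
  have h4 : a x ⬝ᵥ ((conn g x u)ᵀ * M x) *ᵥ b x = (conn g x u *ᵥ a x) ⬝ᵥ M x *ᵥ b x := by
    rw [← mulVec_mulVec, dotProduct_mulVec, vecMul_transpose]
  rw [← mulVec_mulVec] at h4
  simp only [cov, add_mulVec, dotProduct_add, add_dotProduct, mulVec_add, h4, ← mulVec_mulVec]
  ring

lemma christoffel_symm (g : (ι → ℝ) → Matrix ι ι ℝ) (x : ι → ℝ) (U : Set (ι → ℝ))
    (hU : IsOpen U) (hx : x ∈ U) (hs : ∀ y ∈ U, (g y).IsSymm) (l j k : ι) :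
    christoffel g x l j k = christoffel g x l k j := by
  have h : ∀ m, pd m (fun y => g y j k) x = pd m (fun y => g y k j) x := by
    intro m
    unfold pd
    rw [Filter.EventuallyEq.fderiv_eq]
    filter_upwards [hU.mem_nhds hx] with y hy
    exact ((hs y hy).apply k j)
  unfold christoffel
  congr 1
  refine Finset.sum_congr rfl fun m _ => ?_
  rw [h m]; ring

lemma metric_compat (g : (ι → ℝ) → Matrix ι ι ℝ) (x : ι → ℝ) (U : Set (ι → ℝ))
    (hU : IsOpen U) (hx : x ∈ U) (hs : ∀ y ∈ U, (g y).IsSymm)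
    (hd : IsUnit (g x).det) (i j k : ι) :
    pd k (fun y => g y i j) x
      - (∑ l, christoffel g x l k i * g x l j)
      - (∑ l, christoffel g x l k j * g x i l) = 0 := by
  have h : ∀ m p q, pd m (fun y => g y p q) x = pd m (fun y => g y q p) x := by
    intro m p q
    unfold pd
    rw [Filter.EventuallyEq.fderiv_eq]
    filter_upwards [hU.mem_nhds hx] with y hy
    exact ((hs y hy).apply q p)
  have key : ∀ p q r, ∑ l, christoffel g x l p q * g x r l = 
      (1/2) * (pd p (fun y => g y r q) x + pd q (fun y => g y r p) x
        - pd r (fun y => g y p q) x) := by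
    intro p q r
    set v : ι → ℝ := fun m => pd p (fun y => g y m q) x + pd q (fun y => g y m p) x
        - pd m (fun y => g y p q) x with hv
    have h1 : (g x *ᵥ ((g x)⁻¹ *ᵥ v)) r = v r := by
      rw [mulVec_mulVec, Matrix.mul_nonsing_inv _ hd, one_mulVec]
    have h2 : ∑ l, christoffel g x l p q * g x r l = (1/2) * (g x *ᵥ ((g x)⁻¹ *ᵥ v)) r := by
      rw [mulVec, dotProduct, Finset.mul_sum]
      refine Finset.sum_congr rfl fun l _ => ?_
      simp only [christoffel, mulVec, dotProduct, hv]
      ring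
    rw [h2, h1]
  have e1 : ∑ l, christoffel g x l k i * g x l j = ∑ l, christoffel g x l k i * g x j l := by
    refine Finset.sum_congr rfl fun l _ => ?_
    rw [(hs x hx).apply]
  rw [e1, key, key, h k j i, h i j k, h j i k]
  ring

lemma torsion_free (g : (ι → ℝ) → Matrix ι ι ℝ) (x : ι → ℝ) (U : Set (ι → ℝ))
    (hU : IsOpen U) (hx : x ∈ U) (hs : ∀ y ∈ U, (g y).IsSymm) (a b : (ι → ℝ) → ι → ℝ) :
    cov g x (a x) b - cov g x (b x) a = dvec b x (a x) - dvec a x (b x) := by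
  have : conn g x (a x) *ᵥ b x = conn g x (b x) *ᵥ a x := by
    ext c
    simp only [mulVec, dotProduct, conn, Finset.sum_mul]
    rw [Finset.sum_comm]
    refine Finset.sum_congr rfl fun l _ => Finset.sum_congr rfl fun k _ => ?_
    rw [christoffel_symm g x U hU hx hs]
    ring
  simp only [cov, this]
  abel
end helpers

/-- The recursion satisfied by the connection coefficients. -/
def Rec (n : ℕ) (ε : ℝ) (μ : ℕ → ℝ) (m : ℕ) (A : ℕ → ℕ → ℝ) : Prop :=
  ∀ j k, 1 ≤ j → j ≤ n → 1 ≤ k → k ≤ n →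
    μ m * (if j + k = n + 1 then ε else 0) + A (j-1) k - A j (k-1)
      = (n/2) * (μ j * (if k + m = n + 1 then ε else 0) + μ k * (if j + m = n + 1 then ε else 0))

lemma rec_mu (n : ℕ) (ε : ℝ) (hε : ε ≠ 0) (μ : ℕ → ℝ) (A : ℕ → ℕ → ℝ)
    (h0 : ∀ k, A 0 k = 0) (h0' : ∀ k, A k 0 = 0) (hr : Rec n ε μ n A) (t : ℕ) (ht : 1 ≤ t)
    (htn : t < n) : μ t = 0 := by
  have key : ∀ d, d ≤ t → A d (t - d) =
      - (n/2) * ε * μ t * ((if 1 ≤ d then 1 else 0) + (if d = t then 1 else 0)) := by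
    intro d
    induction d with
    | zero => intro _; rw [h0]; simp [show ¬ (0 = t) by omega]
    | succ d ih =>
      intro hd
      have h1 := ih (by omega)
      have h2 := hr (d+1) (t-d) (by omega) (by omega) (by omega) (by omega)
      rw [if_neg (by omega), show d + 1 - 1 = d by omega, show t - d - 1 = t - (d+1) by omega,
        h1] at h2
      by_cases c1 : d = 0 <;> by_cases c2 : d + 1 = t
      · subst c1; subst c2; simp [add_comm 1 n] at h2 ⊢; linarith
      · subst c1
        rw [if_neg (show ¬ (t - 0 + n = n + 1) by omega)] at h2
        simp [c2, show ¬ (0 = t) by omega, Nat.add_comm] at h2 ⊢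
        linarith
      · rw [if_pos (show t - d + n = n + 1 by omega),
          if_neg (show ¬ (d + 1 + n = n + 1) by omega), c2] at h2
        simp [c2, show ¬ (d = t) by omega, show 1 ≤ d by omega, ht] at h2 ⊢
        linarith
      · rw [if_neg (show ¬ t - d + n = n + 1 by omega),
          if_neg (show ¬ (d + 1 + n = n + 1) by omega)] at h2
        simp [c2, show ¬ (d = t) by omega, show 1 ≤ d by omega] at h2 ⊢
        linarith
  have h := key t le_rfl
  rw [Nat.sub_self, h0'] at h
  simp [ht] at h
  have hn : n ≠ 0 := by omega
  norm_num [hn, hε] at h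
  exact h

lemma rec_lt (n : ℕ) (ε : ℝ) (μ : ℕ → ℝ) (m : ℕ) (hm : 1 ≤ m) (hmn : m < n) (A : ℕ → ℕ → ℝ)
    (h0 : ∀ k, A 0 k = 0) (ha : ∀ j k, j ≤ n → k ≤ n → A j k = - A k j)
    (hμ : ∀ t, 1 ≤ t → t < n → μ t = 0) (hr : Rec n ε μ m A) (p q : ℕ) (hp : p ≤ n) (hq : q ≤ n) :
    A p q = (n/2) * ε * μ n * ((if p + m = n ∧ q = n then 1 else 0)
      - (if p = n ∧ q + m = n then 1 else 0)) := by
  have R : ∀ j k, 1 ≤ j → j ≤ n → 1 ≤ k → k ≤ n → A (j-1) k - A j (k-1)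
      = (n/2) * ε * μ n * ((if j = n ∧ k + m = n + 1 then 1 else 0)
        + (if k = n ∧ j + m = n + 1 then 1 else 0)) := by
    intro j k h1 h2 h3 h4
    have h := hr j k h1 h2 h3 h4
    rw [hμ m hm hmn, zero_mul, zero_add] at h
    rw [h]
    have e : ∀ j, 1 ≤ j → j ≤ n → μ j = if j = n then μ n else 0 := by
      intro j hj hj'
      split_ifs with c
      · rw [c]
      · exact hμ j hj (by omega)
    rw [e j h1 h2, e k h3 h4, ite_and, ite_and]
    split_ifs <;> ring
  have key : ∀ p, p < n → ∀ d, p + d ≤ n → A p n = A (p+d) (n-d) + (n/2) * ε * μ n *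
      ((if 1 ≤ d ∧ p + m = n then 1 else 0) + (if p + d = n ∧ p + m = n then 1 else 0)) := by
    intro p hp d
    induction d with
    | zero => intro _; simp [show p ≠ n by omega]
    | succ d ih =>
      intro hd
      rw [ih (by omega)]
      have h := R (p+d+1) (n-d) (by omega) (by omega) (by omega) (by omega)
      rw [show p + d + 1 - 1 = p + d by omega, show n - d - 1 = n - (d+1) by omega] at h
      rw [← add_assoc, eq_add_of_sub_eq h]
      rw [add_comm _ (A _ _), add_assoc, ← mul_add]
      congr 2
      have e1 : (p + d + 1 = n ∧ n - d + m = n + 1) ↔ (p + d + 1 = n ∧ p + m = n) := by omega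
      have e2 : (n - d = n ∧ p + d + 1 + m = n + 1) ↔ (d = 0 ∧ p + m = n) := by omega
      have e3 : ¬ (p + d = n ∧ p + m = n) := by omega
      simp only [e1, e2, e3, if_false]
      by_cases c : p + m = n <;> by_cases c1 : d = 0 <;> simp [c, c1, Nat.one_le_iff_ne_zero] <;> ring
  have top : ∀ p, p ≤ n → A p n = (n/2) * ε * μ n * (if p + m = n then 1 else 0) := by
    intro p hp
    rcases Nat.lt_or_ge p n with h | h
    · have h1 := key p h (n-p) (by omega)
      rw [show p + (n-p) = n by omega, show n - (n-p) = p by omega, ha n p le_rfl hp] at h1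
      simp [show 1 ≤ n - p by omega] at h1
      simp
      split_ifs at h1 ⊢ <;> linarith
    · obtain rfl : p = n := by omega
      have := ha p p le_rfl le_rfl
      rw [if_neg (by omega)]
      linarith
  induction p generalizing q with
  | zero =>
    rw [h0]; simp [show m ≠ n by omega, show ¬ (0 = n) by omega]
  | succ p ih =>
    rcases Nat.lt_or_ge q n with h | h
    · have h1 := R (p+1) (q+1) (by omega) hp (by omega) (by omega)
      simp only [Nat.add_sub_cancel] at h1
      rw [ih (q+1) (by omega) (by omega)] at h1
      have e : A (p+1) q = A (p+1) q := rfl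
      have e1 : ¬ (p + 1 + m = n ∧ q = n) := by omega
      have e2 : (p + 1 = n ∧ q + 1 + m = n + 1) ↔ (p + 1 = n ∧ q + m = n) := by omega
      have e3 : (q + 1 = n ∧ p + 1 + m = n + 1) ↔ (p + m = n ∧ q + 1 = n) := by omega
      have e4 : ¬ (p = n ∧ q + 1 + m = n) := by omega
      simp only [e1, e2, e3, e4, if_false] at h1 ⊢
      linarith
    · obtain rfl : q = n := by omega
      rw [top _ hp]
      simp [show m ≠ 0 by omega]

lemma rec_top (n : ℕ) (ε : ℝ) (μ : ℕ → ℝ) (A : ℕ → ℕ → ℝ)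
    (h0 : ∀ k, A 0 k = 0) (h0' : ∀ k, A k 0 = 0) (ha : ∀ j k, j ≤ n → k ≤ n → A j k = - A k j)
    (hμ : ∀ t, 1 ≤ t → t < n → μ t = 0) (hr : Rec n ε μ n A) (p q : ℕ) (hp : p < n) 
    (hq : q ≤ n) (hp1 : 1 ≤ p) (hq1 : 1 ≤ q) :
    A p q = if p + q = n then (p - n/2) * ε * μ n else 0 := by
  have R : ∀ j k, 1 ≤ j → j < n → 1 ≤ k → k ≤ n → A (j-1) k - A j (k-1)
      = (if k = n ∧ j = 1 then n/2 * ε * μ n else 0) - (if j + k = n + 1 then ε * μ n else 0) := by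
    intro j k h1 h2 h3 h4
    have h := hr j k h1 (by omega) h3 h4
    rw [hμ j h1 h2] at h
    by_cases c : k = n
    · subst c
      simp only [show j + k = k + 1 ↔ j = 1 by omega, true_and, show k + k = k + 1 ↔ k = 1 by omega] at h ⊢
      split_ifs at h ⊢ <;> first | linarith | omega
    · rw [hμ k h3 (by omega)] at h
      simp [c] at h ⊢
      split_ifs at h ⊢ <;> linarith
  have R0 : ∀ j k, 2 ≤ j → j ≤ n → 2 ≤ k → k ≤ n → n + 1 < j + k → A (j-1) k = A j (k-1) := by
    intro j k h1 h2 h3 h4 h5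
    have h := hr j k (by omega) h2 (by omega) h4
    simp [show j + k ≠ n + 1 by omega, show k ≠ 1 by omega, show j ≠ 1 by omega, add_comm k n,
      add_comm j n] at h
    linarith
  have top : ∀ p, 1 ≤ p → p ≤ n → A p n = 0 := by
    intro p hp1 hp
    have key : ∀ d, p + d ≤ n → A p n = A (p+d) (n-d) := by
      intro d
      induction d with
      | zero => intro _; simp
      | succ d ih =>
        intro hd
        rw [ih (by omega)]
        exact R0 (p+d+1) (n-d) (by omega) (by omega) (by omega) (by omega) (by omega)
    have h1 := key (n-p) (by omega)
    rw [show p + (n-p) = n by omega, show n - (n-p) = p by omega, ha n p le_rfl hp] at h1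
    linarith
  induction p, hp1 using Nat.le_induction generalizing q with
  | base =>
    rcases Nat.lt_or_ge q n with h | h
    · have h1 := R 1 (q+1) (by omega) hp (by omega) (by omega)
      rw [Nat.sub_self, h0, Nat.add_sub_cancel] at h1
      by_cases c : 1 + q = n
      · rw [if_pos ⟨by omega, rfl⟩, if_pos (by omega)] at h1
        rw [if_pos c]
        push_cast
        linarith
      · rw [if_neg (by omega), if_neg (by omega)] at h1
        rw [if_neg c]
        linarith
    · obtain rfl : q = n := by omega
      rw [top _ le_rfl (by omega), if_neg (by omega)]
  | succ p hp1 ih =>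
    rcases Nat.lt_or_ge q n with h | h
    · have h1 := R (p+1) (q+1) (by omega) hp (by omega) (by omega)
      rw [Nat.add_sub_cancel, Nat.add_sub_cancel, ih (q+1) (by omega) (by omega) (by omega)] at h1
      simp only [show p + 1 + (q + 1) = n + 1 ↔ p + 1 + q = n by omega,
        show p + (q + 1) = n ↔ p + 1 + q = n by omega,
        show ¬ (q + 1 = n ∧ p + 1 = 1) by omega, if_false] at h1
      push_cast
      split_ifs at h1 ⊢ <;> linarith
    · obtain rfl : q = n := by omega
      rw [top _ (by omega) (by omega), if_neg (by omega)]

lemma symm_swap {n : ℕ} (M : Matrix (Fin n) (Fin n) ℝ) (hM : M.IsSymm) (v w : Fin n → ℝ) :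
    v ⬝ᵥ M *ᵥ w = w ⬝ᵥ M *ᵥ v := by
  rw [dotProduct_mulVec, ← mulVec_transpose, hM.eq, dotProduct_comm]

lemma core (n : ℕ) (hn : 1 ≤ n) (U : Set (Fin n → ℝ)) (hU : IsOpen U)
    (E : ℕ → (Fin n → ℝ) → (Fin n → ℝ))
    (x : Fin n → ℝ) (hx : x ∈ U)
    (hE0 : E 0 = fun _ => 0)
    (hEd : ∀ j c, DifferentiableAt ℝ (fun y => E j y c) x)
    (ε : ℝ) (hε : ε ≠ 0)
    (lam : (Fin n → ℝ) → ℝ) (hlam : DifferentiableAt ℝ lam x)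
    (g L : (Fin n → ℝ) → Matrix (Fin n) (Fin n) ℝ)
    (hEg : ∀ y ∈ U, ∀ i j, i ≤ n → j ≤ n →
      E i y ⬝ᵥ g y *ᵥ E j y = if i + j = n + 1 then ε else 0)
    (hEL : ∀ y ∈ U, ∀ j, 1 ≤ j → j ≤ n → L y *ᵥ E j y = lam y • E j y + E (j-1) y)
    (hnd : ∀ v : Fin n → ℝ, (∀ k, 1 ≤ k → k ≤ n → v ⬝ᵥ g x *ᵥ E k x = 0) → v = 0)
    (htr : ∀ y ∈ U, (L y).trace = n * lam y)
    (hcomp : IsCompatiblePair U g L) :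
    (∀ i j, 1 ≤ i → 1 ≤ j → i < n → j < n →
      dvec (E j) x (E i x) - dvec (E i) x (E j x) = 0) ∧
    (∀ i, 1 ≤ i → i < n → dvec (E n) x (E i x) - dvec (E i) x (E n x)
      = (-(i:ℝ) * fderiv ℝ lam x (E n x)) • E (i+1) x) := by
  obtain ⟨hgs, hLs, hsy, hco⟩ := hcomp
  have hUx := hU.mem_nhds hx
  have hgd : ∀ i j, DifferentiableAt ℝ (fun y => g y i j) x := fun i j =>
    ((hgs i j).contDiffAt hUx).differentiableAt (by simp)
  have hLd : ∀ i j, DifferentiableAt ℝ (fun y => L y i j) x := fun i j =>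
    ((hLs i j).contDiffAt hUx).differentiableAt (by simp)
  have hgLd : ∀ i j, DifferentiableAt ℝ (fun y => (g y * L y) i j) x := by
    intro i j
    simp only [Matrix.mul_apply]
    exact DifferentiableAt.fun_sum fun k _ => (hgd i k).mul (hLd k j)
  obtain ⟨hsx, hdx, -, hgLx⟩ := hsy x hx
  have hs : ∀ y ∈ U, (g y).IsSymm := fun y hy => (hsy y hy).1
  set A : ℕ → ℕ → ℕ → ℝ := fun m j k => cov g x (E m x) (E j) ⬝ᵥ g x *ᵥ E k x with hA
  set μ : ℕ → ℝ := fun m => fderiv ℝ lam x (E m x) with hμd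
  have hcov0 : ∀ u, cov g x u (E 0) = 0 := by
    intro u
    ext c
    simp [cov, dvec, hE0, mulVec, dotProduct]
  have hA0 : ∀ m k, A m 0 k = 0 := by
    intro m k; simp [hA, hcov0]
  have hA0' : ∀ m k, A m k 0 = 0 := by
    intro m k
    simp only [hA, hE0]
    have : g x *ᵥ (fun _ => (0:ℝ) : Fin n → ℝ) = 0 := mulVec_zero _
    simp [dotProduct, mulVec]
  have hanti : ∀ m j k, j ≤ n → k ≤ n → A m j k = - A m k j := by
    intro m j k hj hk
    have h1 := leibniz g g (E j) (E k) x (E m x) (fun _ _ _ => 0) hgd (hEd j) (hEd k)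
      (metric_compat g x U hU hx hs hdx)
    have h2 : (fun y => E j y ⬝ᵥ g y *ᵥ E k y) =ᶠ[nhds x]
        fun _ => if j + k = n + 1 then ε else 0 := by
      filter_upwards [hUx] with y hy
      exact hEg y hy j k hj hk
    rw [h2.fderiv_eq, symm_swap _ hsx (E j x)] at h1
    simp at h1
    simp only [hA]
    linarith
  have hτ : ∀ v, fderiv ℝ (fun y => (1/2) * (L y).trace) x v = n/2 * fderiv ℝ lam x v := by
    intro v
    have h2 : (fun y => (1/2) * (L y).trace) =ᶠ[nhds x] fun y => (n/2 : ℝ) * lam y := by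
      filter_upwards [hUx] with y hy
      rw [htr y hy]; ring
    rw [h2.fderiv_eq, fderiv_const_mul hlam]
    simp
  have hrec : ∀ m, m ≤ n → Rec n ε μ m (A m) := by
    intro m hm j k hj hj' hk hk'
    have h1 := leibniz g (fun y => g y * L y) (E j) (E k) x (E m x) _ hgLd (hEd j) (hEd k)
      (hco x hx)
    have h2 : (fun y => E j y ⬝ᵥ (g y * L y) *ᵥ E k y) =ᶠ[nhds x]
        fun y => (if j + k = n + 1 then ε else 0) * lam y
          + (if j + (k-1) = n + 1 then ε else 0) := by
      filter_upwards [hUx] with y hy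
      rw [← mulVec_mulVec, hEL y hy k hk hk', mulVec_add, mulVec_smul, dotProduct_add,
        dotProduct_smul, hEg y hy j k hj' hk', hEg y hy j (k-1) hj' (by omega), smul_eq_mul]
      ring
    have h3 : ∀ v p, 1 ≤ p → p ≤ n → v ⬝ᵥ (g x * L x) *ᵥ E p x
        = lam x * (v ⬝ᵥ g x *ᵥ E p x) + v ⬝ᵥ g x *ᵥ E (p-1) x := by
      intro v p hp hp'
      rw [← mulVec_mulVec, hEL x hx p hp hp', mulVec_add, mulVec_smul, dotProduct_add,
        dotProduct_smul, smul_eq_mul]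
    have h4 : ∀ a b u : Fin n → ℝ, ∑ i, ∑ j, ∑ k,
        (pd i (fun y => (1/2) * (L y).trace) x * g x j k
          + pd j (fun y => (1/2) * (L y).trace) x * g x i k) * a i * b j * u k
        = n/2 * fderiv ℝ lam x a * (b ⬝ᵥ g x *ᵥ u) + n/2 * fderiv ℝ lam x b * (a ⬝ᵥ g x *ᵥ u) := by
      intro a b u
      rw [← hτ, ← hτ, fderiv_eq_sum_pd, fderiv_eq_sum_pd]
      simp only [dotProduct, mulVec, Finset.sum_mul_sum, add_mul,
        Finset.sum_add_distrib]
      simp only [Finset.mul_sum]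
      congr 1
      · refine Finset.sum_congr rfl fun i _ => Finset.sum_congr rfl fun j _ =>
          Finset.sum_congr rfl fun k _ => by ring
      · rw [Finset.sum_comm]
        refine Finset.sum_congr rfl fun i _ => Finset.sum_congr rfl fun j _ =>
          Finset.sum_congr rfl fun k _ => by ring
    have h5 : fderiv ℝ (fun y => (if j + k = n + 1 then ε else 0) * lam y
          + (if j + (k-1) = n + 1 then ε else 0)) x (E m x)
        = (if j + k = n + 1 then ε else 0) * μ m := by
      rw [fderiv_add_const, fderiv_const_mul hlam]
      simp only [hμd, _root_.smul_apply, smul_eq_mul]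
    rw [h2.fderiv_eq, h5, symm_swap _ hgLx (E j x), h3 _ k hk hk', h3 _ j hj hj', h4,
      hEg x hx k m hk' hm, hEg x hx j m hj' hm] at h1
    have a1 := hanti m j k hj' hk'
    have a2 := hanti m k (j-1) hk' (by omega)
    simp only [hA] at a1 a2 
    simp only [hA, hμd] at h1 ⊢
    rw [a1, a2] at h1
    linear_combination h1
  have hμ : ∀ t, 1 ≤ t → t < n → μ t = 0 := fun t h1 h2 =>
    rec_mu n ε hε μ (A n) (hA0 n) (hA0' n) (hrec n le_rfl) t h1 h2
  have hlt : ∀ m, 1 ≤ m → m < n → _ := fun m h1 h2 =>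
    rec_lt n ε μ m h1 h2 (A m) (hA0 m) (hanti m) hμ (hrec m h2.le)
  have htop := rec_top n ε μ (A n) (hA0 n) (hA0' n) (hanti n) hμ (hrec n le_rfl)
  constructor
  · intro i j hi hj hi' hj'
    rw [← torsion_free g x U hU hx hs]
    apply hnd
    intro k hk hk'
    rw [sub_dotProduct]
    have h1 := hlt i hi hi' j k hj'.le hk'
    have h2 := hlt j hj hj' i k hi'.le hk'
    simp only [hA] at h1 h2
    rw [h1, h2, if_neg (show ¬ (j = n ∧ k + i = n) by omega),
      if_neg (show ¬ (i = n ∧ k + j = n) by omega), add_comm i j, sub_self]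
  · intro i hi hi'
    rw [← torsion_free g x U hU hx hs, ← sub_eq_zero]
    apply hnd
    intro k hk hk'
    rw [sub_dotProduct, sub_dotProduct, smul_dotProduct, hEg x hx (i+1) k (by omega) hk',
      smul_eq_mul]
    have h1 := hlt i hi hi' n k le_rfl hk'
    have h2 := htop i k hi' hk' hi hk
    simp only [hA] at h1 h2
    simp only [true_and] at h1
    rw [h1, h2, if_neg (show ¬ (n + i = n ∧ k = n) by omega)]
    by_cases c : i + k = n
    · rw [if_pos (show k + i = n by omega), if_pos c, if_pos (by omega)]
      ring
    · rw [if_neg (show ¬ k + i = n by omega), if_neg c, if_neg (by omega)]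
      ring

/-- commutation relations of the canonical frame for a real Jordan
block: (a) e_1, …, e_{n-1} pairwise commute; (b) [e_i, e_n] = -i·e_n(λ)·e_{i+1}.
The Lie bracket is [X, Y](x) = DY(x)·X(x) − DX(x)·Y(x), computed componentwise. -/
theorem canonical_frame_commutation_relations
    (n : ℕ) (hn : 1 ≤ n) (U : Set (Fin n → ℝ)) (hU : IsOpen U)
    (e : Fin n → (Fin n → ℝ) → (Fin n → ℝ))
    (he : ∀ i : Fin n, ∀ c : Fin n, ContDiffOn ℝ (⊤ : ℕ∞) (fun y => e i y c) U)
    (hli : ∀ x ∈ U, LinearIndependent ℝ (fun i : Fin n => e i x))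
    (ε : ℝ) (hε : ε = 1 ∨ ε = -1)
    (lam : (Fin n → ℝ) → ℝ) (hlam : ContDiffOn ℝ (⊤ : ℕ∞) lam U)
    (hlam0 : ∀ x ∈ U, lam x ≠ 0)
    (g L : (Fin n → ℝ) → Matrix (Fin n) (Fin n) ℝ)
    (hg : ∀ x ∈ U, (g x).IsSymm ∧ ∀ i j : Fin n,
      e i x ⬝ᵥ (g x).mulVec (e j x) = if (i : ℕ) + (j : ℕ) + 1 = n then ε else 0)
    (hL : ∀ x ∈ U, ∀ j : Fin n, (L x).mulVec (e j x) =
      lam x • e j x +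
        (if h : (j : ℕ) = 0 then 0 else e ⟨(j : ℕ) - 1, by omega⟩ x))
    (hcomp : IsCompatiblePair U g L) :
    ∀ x ∈ U,
      (∀ i j : Fin n, (i : ℕ) + 2 ≤ n → (j : ℕ) + 2 ≤ n →
        (fun c => fderiv ℝ (fun y => e j y c) x (e i x)
          - fderiv ℝ (fun y => e i y c) x (e j x)) = (0 : Fin n → ℝ)) ∧
      (∀ i : Fin n, (hi : (i : ℕ) + 2 ≤ n) →
        (fun c => fderiv ℝ (fun y => e ⟨n - 1, by omega⟩ y c) x (e i x)
          - fderiv ℝ (fun y => e i y c) x (e ⟨n - 1, by omega⟩ x))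
        = (-(((i : ℕ) + 1 : ℝ)) * fderiv ℝ lam x (e ⟨n - 1, by omega⟩ x)) •
            e ⟨(i : ℕ) + 1, by omega⟩ x) := by
  intro x hx
  have hUx := hU.mem_nhds hx
  set E : ℕ → (Fin n → ℝ) → (Fin n → ℝ) := fun j y =>
    if h : 1 ≤ j ∧ j ≤ n then e ⟨j - 1, by omega⟩ y else 0 with hE
  have hEs : ∀ i : Fin n, E (i + 1) = e i := by
    intro i
    funext y
    simp only [hE]
    rw [dif_pos ⟨by omega, by omega⟩]
    rfl
  have hE0 : E 0 = fun _ => 0 := by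
    funext y; simp [hE]
  have hEof : ∀ j, 1 ≤ j → j ≤ n → ∃ i : Fin n, (i : ℕ) + 1 = j := fun j h1 h2 =>
    ⟨⟨j - 1, by omega⟩, by simp; omega⟩
  have hEd : ∀ j c, DifferentiableAt ℝ (fun y => E j y c) x := by
    intro j c
    by_cases h : 1 ≤ j ∧ j ≤ n
    · obtain ⟨i, rfl⟩ := hEof j h.1 h.2
      rw [hEs]
      exact ((he i c).contDiffAt hUx).differentiableAt (by simp)
    · simp [hE, h]
  have hε0 : ε ≠ 0 := by rcases hε with h | h <;> rw [h] <;> norm_num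
  have hEg : ∀ y ∈ U, ∀ i j, i ≤ n → j ≤ n →
      E i y ⬝ᵥ g y *ᵥ E j y = if i + j = n + 1 then ε else 0 := by
    intro y hy i j hi hj
    rcases Nat.eq_zero_or_pos i with h | h
    · subst h
      rw [hE0, if_neg (by omega)]
      exact zero_dotProduct _
    rcases Nat.eq_zero_or_pos j with h' | h'
    · subst h'
      rw [hE0, if_neg (by omega)]
      have : g y *ᵥ (fun _ => (0:ℝ) : Fin n → ℝ) = 0 := mulVec_zero _
      simp [dotProduct, mulVec]
    obtain ⟨i, rfl⟩ := hEof i h hi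
    obtain ⟨j, rfl⟩ := hEof j h' hj
    rw [hEs, hEs, (hg y hy).2 i j]
    congr 1
    apply propext
    omega
  have hEL : ∀ y ∈ U, ∀ j, 1 ≤ j → j ≤ n → L y *ᵥ E j y = lam y • E j y + E (j-1) y := by
    intro y hy j h1 h2
    obtain ⟨j, rfl⟩ := hEof j h1 h2
    rw [hEs, hL y hy j]
    congr 1
    split_ifs with h
    · rw [h, hE0]
    · rw [Nat.add_sub_cancel, ← hEs]
      congr 1
      simp only
      omega
  have hP : ∀ y ∈ U, IsUnit (Matrix.of fun i j => e j y i : Matrix (Fin n) (Fin n) ℝ) := by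
    intro y hy
    exact Matrix.linearIndependent_cols_iff_isUnit.mp (hli y hy)
  have hnd : ∀ v : Fin n → ℝ, (∀ k, 1 ≤ k → k ≤ n → v ⬝ᵥ g x *ᵥ E k x = 0) → v = 0 := by
    intro v hv
    have hgu : IsUnit (g x) := (Matrix.isUnit_iff_isUnit_det _).mpr (hcomp.2.2.1 x hx).2.1
    have h1 : v ᵥ* (g x * (Matrix.of fun i j => e j x i)) = 0 := by
      ext k
      have := hv (k+1) (by omega) (by omega)
      rw [hEs, dotProduct_mulVec] at this
      rw [← vecMul_vecMul]
      exact this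
    exact Matrix.vecMul_injective_of_isUnit (hgu.mul (hP x hx)) (by simpa using h1)
  have htr : ∀ y ∈ U, (L y).trace = n * lam y := by
    intro y hy
    set P : Matrix (Fin n) (Fin n) ℝ := Matrix.of fun i j => e j y i with hPd
    set N : Matrix (Fin n) (Fin n) ℝ := Matrix.of fun i j => if (i:ℕ) + 1 = j then 1 else 0 with hN
    have h1 : L y * P = P * (lam y • (1 : Matrix (Fin n) (Fin n) ℝ) + N) := by
      ext i j
      have := congrFun (hL y hy j) i
      rw [mul_add, Matrix.mul_smul, mul_one, Matrix.add_apply, Matrix.smul_apply]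
      have e1 : (L y * P) i j = (L y *ᵥ e j y) i := rfl
      rw [e1, this, Pi.add_apply, Pi.smul_apply]
      congr 1
      rw [Matrix.mul_apply]
      split_ifs with h
      · rw [Finset.sum_eq_zero]
        · rfl
        · intro k _
          simp [hN, show ¬ ((k:ℕ) + 1 = j) by omega]
      · rw [Finset.sum_eq_single ⟨(j:ℕ) - 1, by omega⟩]
        · simp [hN, hPd, show (j:ℕ) - 1 + 1 = j by omega]
        · intro k _ hk
          have : ¬ ((k:ℕ) + 1 = j) := fun h' => hk (by ext; simp; omega)
          simp [hN, this]
        · simp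
    have hd := (Matrix.isUnit_iff_isUnit_det _).mp (hP y hy)
    have h2 : L y = P * (lam y • (1 : Matrix (Fin n) (Fin n) ℝ) + N) * P⁻¹ := by
      rw [← h1, Matrix.mul_assoc, Matrix.mul_nonsing_inv _ hd, Matrix.mul_one]
    rw [h2, Matrix.trace_mul_comm, ← Matrix.mul_assoc, Matrix.nonsing_inv_mul _ hd, Matrix.one_mul,
      Matrix.trace_add, Matrix.trace_smul, Matrix.trace_one]
    have h3 : N.trace = 0 := by
      simp [Matrix.trace, hN]
    rw [h3]
    simp [mul_comm]
  obtain ⟨ha, hb⟩ := core n hn U hU E x hx hE0 hEd ε hε0 lam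
    ((hlam.contDiffAt hUx).differentiableAt (by simp)) g L hEg hEL hnd htr hcomp
  have hEn : E n = e ⟨n - 1, by omega⟩ := by
    rw [← hEs]; congr 1; simp only; omega
  constructor
  · intro i j hi hj
    have := ha (i+1) (j+1) (by omega) (by omega) (by omega) (by omega)
    rw [hEs, hEs] at this
    exact this
  · intro i hi
    have := hb (i+1) (by omega) (by omega)
    have h2 : E (i + 1 + 1) = e ⟨(i : ℕ) + 1, by omega⟩ := hEs ⟨(i : ℕ) + 1, by omega⟩
    rw [h2, hEs, hEn] at this
    push_cast at this
    exact this
end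

section
/- Analytic dependence of the canonical complex structure. Let W := { A ∈ Mat_n(ℝ) : A has no real eigenvalue }. Then W is an open subset of Mat_n(ℝ), and the map A ↦ J(A) is real-analytic on W, where J(A) denotes the unique matrix J ∈ Mat_n(ℝ) with J² = −I, J A = A J, and such that for every μ ∈ ℂ with Im μ > 0 the generalized eigenspace of A (viewed as a complex matrix) for μ is contained in the eigenspace of J (viewed as a complex matrix) for the eigenvalue i. -/
open Matrix

attribute [local instance] Matrix.normedAddCommGroup Matrix.normedSpace


namespace CCS
open Real Set

section Banach
variable {E : Type*} [NormedRing E] [NormedAlgebra ℝ E]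

abbrev I : Type := Set.Icc (0:ℝ) π

def constL : E →L[ℝ] C(I, E) where
  toFun a := ContinuousMap.const _ a
  map_add' _ _ := rfl
  map_smul' _ _ := rfl
  cont := ContinuousMap.continuous_const'

theorem constL_apply (a : E) (t : I) : (constL a : C(I, E)) t = a := rfl

/-- integral over `[0, π]` as a continuous linear map -/
noncomputable def intL : C(I, E) →L[ℝ] E :=
  LinearMap.mkContinuous
    { toFun := fun f => ∫ t in (0:ℝ)..π, f (Set.projIcc 0 π pi_pos.le t)
      map_add' := fun f g => by
        simp only [ContinuousMap.add_apply]
        exact intervalIntegral.integral_add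
          ((f.continuous.comp continuous_projIcc).intervalIntegrable _ _)
          ((g.continuous.comp continuous_projIcc).intervalIntegrable _ _)
      map_smul' := fun c f => by
        simp [intervalIntegral.integral_smul] } π
    (fun f => by
      have := intervalIntegral.norm_integral_le_of_norm_le_const (a := (0:ℝ)) (b := π)
        (f := fun t => f (Set.projIcc 0 π pi_pos.le t)) (C := ‖f‖)
        (fun t _ => f.norm_coe_le_norm _)
      simp only [sub_zero, abs_of_pos pi_pos] at this
      simpa [mul_comm] using this)

theorem intL_apply (f : C(I, E)) :
    intL f = ∫ t in (0:ℝ)..π, f (Set.projIcc 0 π pi_pos.le t) := rfl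

noncomputable def sF : C(I, E) := ⟨fun t => (sin t.1 ^ 2) • (1:E), by fun_prop⟩

noncomputable def K (a : E) : C(I, E) := sF - (⟨fun t => (cos t.1 ^ 2) • (1:E), by fun_prop⟩ : C(I, E)) * (constL a * constL a)

theorem K_apply (a : E) (t : I) : K a t = (sin t.1 ^ 2) • (1:E) - (cos t.1 ^ 2) • (a * a) := by
  simp [K, sF, constL_apply]

noncomputable def G (a : E) : E := π⁻¹ • intL (constL a * Ring.inverse (K a))

theorem G_fix [CompleteSpace E] {j : E} (hj : j * j = -1) : G j = j := by
  have : K j = 1 := by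
    ext t
    simp [K_apply, hj, ← add_smul]
  simp [G, this, intL_apply, constL_apply, smul_smul, pi_pos.ne']

theorem analytic_K (a : E) : AnalyticAt ℝ (K : E → C(I, E)) a := by
  unfold K
  have := (constL (E := E)).analyticAt a
  fun_prop

variable [CompleteSpace E]

theorem analytic_G {a : E} (ha : IsUnit (K a)) : AnalyticAt ℝ (G : E → E) a := by
  unfold G
  have h1 := (constL (E := E)).analyticAt a
  have h2 : AnalyticAt ℝ (fun a : E => Ring.inverse (K a)) a := by
    obtain ⟨u, hu⟩ := ha
    have := analyticAt_inverse (𝕜 := ℝ) u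
    rw [hu] at this
    exact this.comp (analytic_K a)
  have h3 : AnalyticAt ℝ (fun a : E => constL a * Ring.inverse (K a)) a := h1.mul h2
  have h4 : AnalyticAt ℝ (fun a : E => intL (constL a * Ring.inverse (K a))) a :=
    ((intL (E := E)).analyticAt _).comp h3
  exact (((π⁻¹ : ℝ) • ContinuousLinearMap.id ℝ E).analyticAt _).comp h4

theorem isOpen_unit : IsOpen {a : E | IsUnit (K a)} := by
  have : Continuous (K : E → C(I, E)) := 
    continuous_iff_continuousAt.2 fun a => (analytic_K a).continuousAt
  exact Units.isOpen.preimage this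

theorem alg1 {a b w k : E} (s c : ℝ) (hk : k = s • (1:E) - c • (a*a)) (hab : a * b = b * a)
    (h1 : k * w = 1) (h2 : w * k = 1) :
    b * w + a * (-(w * (-(c • (a * b + b * a))) * w)) = b * (s • 1 + c • (a*a)) * w * w := by
  have cka : Commute k a := by
    subst hk
    exact ((Commute.one_left a).smul_left s).sub_left (((Commute.refl a).mul_left (Commute.refl a)).smul_left c)
  have cwa : w * a = a * w := by
    calc w * a = w * a * (k * w) := by rw [h1, mul_one]
      _ = w * (k * a) * w := by rw [cka.eq]; noncomm_ring
      _ = (w * k) * a * w := by noncomm_ring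
      _ = a * w := by rw [h2, one_mul]
  have ckb : Commute k b := by
    subst hk
    exact ((Commute.one_left b).smul_left s).sub_left (((show Commute a b from hab).mul_left (show Commute a b from hab)).smul_left c)
  have cwb : w * b = b * w := by
    calc w * b = w * b * (k * w) := by rw [h1, mul_one]
      _ = w * (k * b) * w := by rw [ckb.eq]; noncomm_ring
      _ = (w * k) * b * w := by noncomm_ring
      _ = b * w := by rw [h2, one_mul]
  have e1 : w * (a * b) = a * b * w := by rw [← mul_assoc, cwa, mul_assoc, cwb, mul_assoc]
  have e2 : b * w = b * k * w * w := by rw [mul_assoc b k w, h1, mul_one]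
  rw [e2, ← hab]
  have e3 : w * -(c • (a * b + a * b)) = -(c • (a * b + a * b)) * w := by
    simp [mul_add, add_mul, e1]
  rw [e3, hk, hab]
  have e4 : a * (b * a) = b * (a * a) := by rw [← mul_assoc, hab, mul_assoc]
  simp only [mul_sub, mul_add, sub_mul, add_mul, neg_mul, mul_neg, neg_neg, mul_smul_comm, smul_mul_assoc, smul_add, mul_one]
  simp only [← mul_assoc] at e4 ⊢
  rw [e4]
  abel

theorem alg2 {a w k : E} (x y : ℝ) (hk : k = (x^2) • (1:E) - (y^2) • (a*a))
    (h1 : k * w = 1) (h2 : w * k = 1) (hs : x^2 + y^2 = 1) :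
    (y * y + x * (-x)) • w + (x * y) • (-(w * ((2 * x * y) • (1:E) + (2 * x * y) • (a*a)) * w))
      = - ((x^2) • 1 + (y^2) • (a*a)) * w * w := by
  have cka : Commute k (a * a) := by
    subst hk
    exact ((Commute.one_left _).smul_left _).sub_left ((Commute.refl _).smul_left _)
  have cwa : w * (a*a) = (a*a) * w := by
    calc w * (a*a) = w * (a*a) * (k * w) := by rw [h1, mul_one]
      _ = w * (k * (a*a)) * w := by rw [cka.eq]; noncomm_ring
      _ = (w * k) * (a*a) * w := by noncomm_ring
      _ = (a*a) * w := by rw [h2, one_mul]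
  have e2 : w = k * w * w := by rw [h1, one_mul]
  have e3 : (y * y + x * (-x)) • w = (y * y + x * (-x)) • (k * w * w) := by rw [← e2]
  rw [e3, hk, mul_add w, mul_smul_comm, mul_smul_comm, cwa]
  generalize a * a = q
  simp only [mul_one, sub_mul, add_mul, neg_mul, smul_mul_assoc, one_mul, smul_sub, smul_neg, smul_add, smul_smul, neg_add]
  have hx : x^2 = 1 - y^2 := by linarith
  have f1 : ∀ z : E, ∀ r s: ℝ, r = s → r • z = s • z := by rintro z r s rfl; rfl
  have : (x^2 : ℝ) = (1 - y^2) := hx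
  match_scalars <;> nlinarith [hx]

/-- the derivative along a commuting direction vanishes -/
theorem int_zero {a b : E} (hab : a * b = b * a) (W : C(I, E)) (h1 : K a * W = 1) (h2 : W * K a = 1)
    (D : C(I, E)) (hD : ∀ t : I, D t = b * ((sin t.1 ^ 2) • 1 + (cos t.1 ^ 2) • (a*a)) * W t * W t) :
    intL D = 0 := by
  have key : ∀ t : ℝ, IsUnit ((sin t ^ 2) • (1:E) - (cos t ^ 2) • (a * a)) → 
    HasDerivAt (fun t : ℝ => (sin t * cos t) • Ring.inverse ((sin t ^ 2) • (1:E) - (cos t ^ 2) • (a * a)))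
     (-((sin t ^ 2) • 1 + (cos t ^ 2) • (a*a)) * Ring.inverse ((sin t ^ 2) • (1:E) - (cos t ^ 2) • (a * a))
      * Ring.inverse ((sin t ^ 2) • (1:E) - (cos t ^ 2) • (a * a))) t := by
    intro t ⟨u, hu⟩
    have d1 : HasDerivAt (fun t : ℝ => (sin t ^ 2) • (1:E) - (cos t ^ 2) • (a * a))
        ((2 * sin t * cos t) • (1:E) + (2 * sin t * cos t) • (a * a)) t := by
      have := (((hasDerivAt_sin t).pow 2).smul_const (1:E)).sub (((hasDerivAt_cos t).pow 2).smul_const (a*a))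
      refine this.congr_deriv ?_
      simp [mul_right_comm]
    have d2 := hasFDerivAt_ringInverse (𝕜 := ℝ) u
    rw [hu] at d2
    have d3 := d2.comp_hasDerivAt t d1
    have d4 := ((hasDerivAt_sin t).mul (hasDerivAt_cos t)).smul d3
    have hw : Ring.inverse ((sin t ^ 2) • (1:E) - (cos t ^ 2) • (a * a)) = ↑(u⁻¹) := by
      rw [← hu, Ring.inverse_unit]
    rw [← alg2 (k := (sin t ^ 2) • (1:E) - (cos t ^ 2) • (a * a)) (sin t) (cos t) rfl (by rw [hw, ← hu]; simp) (by rw [hw, ← hu]; simp) (sin_sq_add_cos_sq t)]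
    refine d4.congr_deriv ?_
    simp [hw]
    abel
  have hu : ∀ t : I, IsUnit ((sin t.1 ^ 2) • (1:E) - (cos t.1 ^ 2) • (a * a)) := by
    intro t
    rw [← K_apply]
    exact ⟨⟨K a t, W t, by rw [← ContinuousMap.mul_apply, h1]; rfl, by rw [← ContinuousMap.mul_apply, h2]; rfl⟩, rfl⟩
  have hW : ∀ t : I, Ring.inverse ((sin t.1 ^ 2) • (1:E) - (cos t.1 ^ 2) • (a * a)) = W t := by
    intro t
    rw [← K_apply]
    exact Ring.inverse_unit (⟨K a t, W t, by rw [← ContinuousMap.mul_apply, h1]; rfl, by rw [← ContinuousMap.mul_apply, h2]; rfl⟩ : Eˣ)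
  rw [intL_apply, intervalIntegral.integral_eq_sub_of_hasDerivAt (f := fun t : ℝ => -b * ((sin t * cos t) • Ring.inverse ((sin t ^ 2) • (1:E) - (cos t ^ 2) • (a * a))))]
  · simp
  · intro t ht
    rw [uIcc_of_le pi_pos.le] at ht
    have := (key t (hu ⟨t, ht⟩)).const_mul (-b)
    refine this.congr_deriv ?_
    rw [projIcc_of_mem _ ht, hD, hW ⟨t, ht⟩]
    simp only [neg_mul, mul_neg, neg_neg, mul_assoc]
  · exact (D.continuous.comp continuous_projIcc).intervalIntegrable _ _

theorem G_const {a b : E} (hab : a * b = b * a)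
    (hU : ∀ r ∈ Set.Icc (0:ℝ) 1, IsUnit (K (a + r • b))) : G a = G (a + b) := by
  have key : ∀ r ∈ Set.Icc (0:ℝ) 1, HasDerivAt (fun r : ℝ => G (a + r • b)) 0 r := by
    intro r hr
    obtain ⟨u, hu⟩ := hU r hr
    have p : HasDerivAt (fun r : ℝ => a + r • b) b r := by
      simpa using ((hasDerivAt_id r).smul_const b).const_add a
    have p1 : HasDerivAt (fun r : ℝ => (constL (a + r • b) : C(I, E))) (constL b) r :=
      (constL (E := E)).hasFDerivAt.comp_hasDerivAt r p
    have p2 := ((p1.mul p1).const_mul (⟨fun t => (cos t.1 ^ 2) • (1:E), by fun_prop⟩ : C(I, E))).const_sub sF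
    have p3 := hasFDerivAt_ringInverse (𝕜 := ℝ) u
    rw [hu] at p3
    have p4 := p3.comp_hasDerivAt r (f := fun r : ℝ => K (a + r • b)) p2
    have p5 := ((intL (E := E)).hasFDerivAt.comp_hasDerivAt r (p1.mul p4)).const_smul π⁻¹
    refine p5.congr_deriv ?_
    have hc : (a + r • b) * b = b * (a + r • b) := by simp [add_mul, mul_add, hab]
    have := int_zero hc (↑u⁻¹ : C(I, E)) (by rw [← hu]; simp) (by rw [← hu]; simp)
    rw [this, smul_zero]
    intro t
    rw [← alg1 (k := K (a + r • b) t) _ _ (K_apply _ t) hc (by rw [← hu, ← ContinuousMap.mul_apply]; simp) (by rw [← hu, ← ContinuousMap.mul_apply]; simp)]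
    have : Ring.inverse (K (a + r • b)) = ↑u⁻¹ := by rw [← hu, Ring.inverse_unit]
    simp [constL_apply, this, hc]
  have := constant_of_has_deriv_right_zero (f := fun r : ℝ => G (a + r • b)) (a := 0) (b := 1)
    (fun r hr => (key r hr).continuousAt.continuousWithinAt)
    (fun r hr => (key r (Ico_subset_Icc_self hr)).hasDerivWithinAt) 1 (by simp)
  simpa using this.symm

end Banach
end CCS

namespace CCS
section LinAlg
variable {n : ℕ}

noncomputable abbrev cx (A : Matrix (Fin n) (Fin n) ℝ) : Matrix (Fin n) (Fin n) ℂ := A.map (algebraMap ℝ ℂ)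

noncomputable abbrev gen (A : Matrix (Fin n) (Fin n) ℝ) (μ : ℂ) : Submodule ℂ (Fin n → ℂ) :=
  LinearMap.ker (Matrix.mulVecLin ((cx A - μ • 1) ^ n))

abbrev NoReal (A : Matrix (Fin n) (Fin n) ℝ) : Prop :=
  ∀ μ : ℝ, (A - μ • (1 : Matrix (Fin n) (Fin n) ℝ)).det ≠ 0

theorem gen_eq (A : Matrix (Fin n) (Fin n) ℝ) (μ : ℂ) :
    gen A μ = Module.End.maxGenEigenspace (Matrix.toLin' (cx A)) μ := by
  rw [Module.End.maxGenEigenspace_eq_genEigenspace_finrank]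
  ext v
  rw [Module.End.mem_genEigenspace_nat]
  have : (Matrix.toLin' (cx A) - μ • 1) = Matrix.toLin' (cx A - μ • 1) := by
    ext; simp
  rw [this, ← Matrix.toLin'_pow]
  rw [LinearMap.mem_ker, LinearMap.mem_ker, Matrix.mulVecLin_apply, Matrix.toLin'_apply,
    Module.finrank_fin_fun]

theorem det_cx (A : Matrix (Fin n) (Fin n) ℝ) (μ : ℝ) :
    (cx A - (μ : ℂ) • 1).det = (((A - μ • (1 : Matrix (Fin n) (Fin n) ℝ)).det : ℝ) : ℂ) := by
  have h := RingHom.map_det (algebraMap ℝ ℂ) (A - μ • (1 : Matrix (Fin n) (Fin n) ℝ))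
  rw [Complex.coe_algebraMap] at h
  rw [h]
  congr 1
  ext i j
  by_cases hij : i = j <;> simp [hij, Matrix.one_apply]

theorem not_real {A : Matrix (Fin n) (Fin n) ℝ} (hA : NoReal A) {μ : ℂ} {v : Fin n → ℂ}
    (hv : v ≠ 0) (h : cx A *ᵥ v = μ • v) : μ.im ≠ 0 := by
  intro him
  have hμ : ((μ.re : ℝ) : ℂ) = μ := by apply Complex.ext <;> simp [him]
  apply hA μ.re
  have : (cx A - ((μ.re : ℝ) : ℂ) • 1).det = 0 := by
    rw [← Matrix.exists_mulVec_eq_zero_iff]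
    refine ⟨v, hv, ?_⟩
    rw [hμ, Matrix.sub_mulVec, h, Matrix.smul_mulVec, Matrix.one_mulVec, sub_self]
  rw [det_cx] at this
  exact_mod_cast this

theorem gen_bot {A : Matrix (Fin n) (Fin n) ℝ} (hA : NoReal A) {μ : ℂ} (hμ : μ.im = 0) :
    gen A μ = ⊥ := by
  rw [gen_eq]
  by_contra hne
  have h1 : Module.End.HasEigenvalue (Matrix.toLin' (cx A)) μ := by
    rw [Module.End.maxGenEigenspace_eq_genEigenspace_finrank] at hne
    exact Module.End.hasEigenvalue_of_hasGenEigenvalue (k := Module.finrank ℂ (Fin n → ℂ)) hne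
  obtain ⟨v, hv⟩ := h1.exists_hasEigenvector
  exact not_real hA hv.2 (by simpa using hv.apply_eq_smul) hμ

theorem ext_gen {A : Matrix (Fin n) (Fin n) ℝ} (hA : NoReal A) {P Q : Matrix (Fin n) (Fin n) ℂ}
    (h : ∀ μ : ℂ, μ.im ≠ 0 → ∀ v ∈ gen A μ, P *ᵥ v = Q *ᵥ v) : P = Q := by
  have key : (⊤ : Submodule ℂ (Fin n → ℂ)) ≤ LinearMap.eqLocus (Matrix.toLin' P) (Matrix.toLin' Q) := by
    rw [← Module.End.iSup_maxGenEigenspace_eq_top (Matrix.toLin' (cx A))]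
    refine iSup_le fun μ => ?_
    rw [← gen_eq]
    by_cases hμ : μ.im = 0
    · rw [gen_bot hA hμ]; exact bot_le
    · intro v hv
      simpa [LinearMap.mem_eqLocus] using h μ hμ v hv
  apply Matrix.toLin'.injective
  exact LinearMap.ext fun v => key (Submodule.mem_top (x := v))

theorem conj_mulVec (M : Matrix (Fin n) (Fin n) ℂ) (v : Fin n → ℂ) :
    (M.map (starRingEnd ℂ)) *ᵥ v = star (M *ᵥ star v) := by
  ext i
  simp [Matrix.mulVec, dotProduct]

theorem star_mem_gen {A : Matrix (Fin n) (Fin n) ℝ} {μ : ℂ} {v : Fin n → ℂ} (hv : v ∈ gen A μ) :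
    star v ∈ gen A (starRingEnd ℂ μ) := by
  have e : (cx A - (starRingEnd ℂ μ) • 1) ^ n = ((cx A - μ • 1) ^ n).map (starRingEnd ℂ) := by
    have := map_pow (starRingEnd ℂ).mapMatrix (cx A - μ • 1) n
    simp only [RingHom.mapMatrix_apply] at this
    rw [this]
    congr 1
    ext i j
    by_cases hij : i = j <;> simp [hij, Matrix.one_apply]
  simp only [gen, LinearMap.mem_ker, Matrix.mulVecLin_apply] at hv ⊢
  rw [e, conj_mulVec, star_star, hv, star_zero]

theorem cx_conj (A : Matrix (Fin n) (Fin n) ℝ) : (cx A).map (starRingEnd ℂ) = cx A := by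
  ext i j; simp

theorem cx_inj {A B : Matrix (Fin n) (Fin n) ℝ} (h : cx A = cx B) : A = B :=
  Matrix.map_injective (algebraMap ℝ ℂ).injective h

theorem exists_J {A : Matrix (Fin n) (Fin n) ℝ} (hA : NoReal A) :
    ∃ J : Matrix (Fin n) (Fin n) ℝ, J * J = -1 ∧ J * A = A * J ∧
      ∀ μ : ℂ, 0 < μ.im → gen A μ ≤ LinearMap.ker (Matrix.mulVecLin (cx J - Complex.I • 1)) := by
  have hind := Module.End.independent_maxGenEigenspace (Matrix.toLin' (cx A))
  have htop := Module.End.iSup_maxGenEigenspace_eq_top (Matrix.toLin' (cx A))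
  have hfe : (fun μ => Module.End.maxGenEigenspace (Matrix.toLin' (cx A)) μ) = gen A := by
    funext μ; rw [gen_eq]
  have hind' : iSupIndep (gen A) := by rw [← hfe]; exact hind
  have htop' : ⨆ μ, gen A μ = ⊤ := by rw [← hfe]; exact htop
  have hc : IsCompl (⨆ μ ∈ {μ : ℂ | 0 < μ.im}, gen A μ) (⨆ μ ∈ {μ : ℂ | μ.im < 0}, gen A μ) := by
    constructor
    · apply hind'.disjoint_biSup_biSup
      rw [Set.disjoint_left]
      intro μ h1 h2
      simp only [Set.mem_ofPred_eq] at h1 h2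
      linarith
    · rw [codisjoint_iff, eq_top_iff, ← htop']
      refine iSup_le fun μ => ?_
      rcases lt_trichotomy μ.im 0 with h | h | h
      · exact le_sup_of_le_right (le_biSup (gen A) (i := μ) (show μ ∈ {μ : ℂ | μ.im < 0} from h))
      · rw [gen_bot hA h]; exact bot_le
      · exact le_sup_of_le_left (le_biSup (gen A) (i := μ) (show μ ∈ {μ : ℂ | 0 < μ.im} from h))
  obtain ⟨J', hp, hm⟩ : ∃ J' : Matrix (Fin n) (Fin n) ℂ,
      (∀ μ : ℂ, 0 < μ.im → ∀ v ∈ gen A μ, J' *ᵥ v = Complex.I • v) ∧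
      (∀ μ : ℂ, μ.im < 0 → ∀ v ∈ gen A μ, J' *ᵥ v = (-Complex.I) • v) := by
    refine ⟨LinearMap.toMatrix' (LinearMap.ofIsCompl hc (Complex.I • Submodule.subtype _)
      ((-Complex.I) • Submodule.subtype _)), ?_, ?_⟩
    · intro μ h v hv
      have hv' := le_biSup (gen A) (i := μ) (show μ ∈ {μ : ℂ | 0 < μ.im} from h) hv
      rw [LinearMap.toMatrix'_mulVec]
      exact LinearMap.ofIsCompl_apply_left hc ⟨v, hv'⟩
    · intro μ h v hv
      have hv' := le_biSup (gen A) (i := μ) (show μ ∈ {μ : ℂ | μ.im < 0} from h) hv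
      rw [LinearMap.toMatrix'_mulVec]
      exact LinearMap.ofIsCompl_apply_right hc ⟨v, hv'⟩
  have hreal : J'.map (starRingEnd ℂ) = J' := by
    apply ext_gen hA
    intro μ hμ v hv
    rw [conj_mulVec]
    rcases lt_or_gt_of_ne hμ with h | h
    · rw [hm μ h v hv, hp _ (by simpa using h) _ (star_mem_gen hv)]
      simp
    · rw [hp μ h v hv, hm _ (by simpa using h) _ (star_mem_gen hv)]
      simp
  have hJ : cx (J'.map Complex.re) = J' := by
    ext i j
    have := congrFun (congrFun hreal i) j
    simp only [Matrix.map_apply] at this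
    simpa using Complex.conj_eq_iff_re.1 this
  have hinv : ∀ μ, ∀ v ∈ gen A μ, cx A *ᵥ v ∈ gen A μ := by
    intro μ v hv
    simp only [gen, LinearMap.mem_ker, Matrix.mulVecLin_apply] at hv ⊢
    have hcom : Commute ((cx A - μ • 1) ^ n) (cx A) := by
      apply Commute.pow_left
      exact (Commute.refl _).sub_left ((Commute.one_left _).smul_left μ)
    rw [Matrix.mulVec_mulVec, hcom.eq, ← Matrix.mulVec_mulVec, hv, Matrix.mulVec_zero]
  refine ⟨J'.map Complex.re, ?_, ?_, ?_⟩
  · apply cx_inj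
    have e1 : cx (J'.map Complex.re * J'.map Complex.re) = J' * J' := by
      rw [cx, Matrix.map_mul, ← cx, hJ]
    have e2 : cx (-1 : Matrix (Fin n) (Fin n) ℝ) = -1 := by
      ext i j
      by_cases hij : i = j <;> simp [hij, Matrix.one_apply]
    rw [e1, e2]
    apply ext_gen hA
    intro μ hμ v hv
    rw [← Matrix.mulVec_mulVec]
    rcases lt_or_gt_of_ne hμ with h | h
    · rw [hm μ h v hv, Matrix.mulVec_smul, hm μ h v hv, smul_smul, Matrix.neg_mulVec]
      simp
    · rw [hp μ h v hv, Matrix.mulVec_smul, hp μ h v hv, smul_smul, Matrix.neg_mulVec]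
      simp
  · apply cx_inj
    rw [cx, cx, Matrix.map_mul, Matrix.map_mul, ← cx, ← cx, hJ]
    apply ext_gen hA
    intro μ hμ v hv
    rw [← Matrix.mulVec_mulVec, ← Matrix.mulVec_mulVec]
    rcases lt_or_gt_of_ne hμ with h | h
    · rw [hm μ h v hv, Matrix.mulVec_smul, hm μ h _ (hinv μ v hv)]
    · rw [hp μ h v hv, Matrix.mulVec_smul, hp μ h _ (hinv μ v hv)]
  · intro μ h v hv
    rw [hJ, LinearMap.mem_ker, Matrix.mulVecLin_apply, Matrix.sub_mulVec, hp μ h v hv,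
      Matrix.smul_mulVec, Matrix.one_mulVec, sub_self]

theorem eig_mem_gen {A : Matrix (Fin n) (Fin n) ℝ} {μ : ℂ} {v : Fin n → ℂ}
    (h : cx A *ᵥ v = μ • v) : v ∈ gen A μ := by
  rw [gen_eq]
  rw [Module.End.mem_maxGenEigenspace]
  exact ⟨1, by simp [h]⟩

theorem path_noReal {A J : Matrix (Fin n) (Fin n) ℝ} (hA : NoReal A) (hJA : J * A = A * J)
    (hJ : ∀ μ : ℂ, 0 < μ.im → gen A μ ≤ LinearMap.ker (Matrix.mulVecLin (cx J - Complex.I • 1)))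
    {r : ℝ} (hr : r ∈ Set.Icc (0:ℝ) 1) : NoReal (A + r • (J - A)) := by
  intro l hl
  set B := A + r • (J - A) with hB
  have hcB : cx B = cx A + (r : ℂ) • (cx J - cx A) := by
    ext i j; simp [hB]
  have hd : (cx B - (l : ℂ) • 1).det = 0 := by rw [det_cx, hl]; simp
  obtain ⟨w, hw, hw0⟩ := Matrix.exists_mulVec_eq_zero_iff.2 hd
  have hcJA : cx J * cx A = cx A * cx J := by
    rw [cx, cx, ← Matrix.map_mul, ← Matrix.map_mul, hJA]
  have hcom : Commute (cx B - (l : ℂ) • 1) (cx A) := by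
    rw [hcB]
    have : Commute (cx J) (cx A) := hcJA
    exact ((Commute.refl _).add_left ((this.sub_left (Commute.refl _)).smul_left _)).sub_left
      ((Commute.one_left _).smul_left _)
  let S : Submodule ℂ (Fin n → ℂ) := LinearMap.ker (Matrix.mulVecLin (cx B - (l : ℂ) • 1))
  have hS : ∀ v ∈ S, Matrix.toLin' (cx A) v ∈ S := by
    intro v hv
    simp only [S, LinearMap.mem_ker, Matrix.mulVecLin_apply, Matrix.toLin'_apply] at hv ⊢
    rw [Matrix.mulVec_mulVec, hcom.eq, ← Matrix.mulVec_mulVec, hv, Matrix.mulVec_zero]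
  have : Nontrivial S := ⟨⟨⟨w, hw0⟩, 0, fun h => hw (congrArg Subtype.val h)⟩⟩
  obtain ⟨μ, hμ⟩ := Module.End.exists_eigenvalue ((Matrix.toLin' (cx A)).restrict hS)
  obtain ⟨v, hv⟩ := hμ.exists_hasEigenvector
  have hv0 : v.1 ≠ 0 := fun h => hv.2 (Subtype.ext h)
  have hAv : cx A *ᵥ v.1 = μ • v.1 := by
    have := congrArg Subtype.val hv.apply_eq_smul
    simpa using this
  have hBv : cx B *ᵥ v.1 = (l : ℂ) • v.1 := by
    have := v.2
    simp only [S, LinearMap.mem_ker, Matrix.mulVecLin_apply, Matrix.sub_mulVec, Matrix.smul_mulVec, Matrix.one_mulVec] at this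
    exact sub_eq_zero.1 this
  have hker : ∀ μ : ℂ, 0 < μ.im → ∀ v ∈ gen A μ, cx J *ᵥ v = Complex.I • v := by
    intro μ h v hv
    have := hJ μ h hv
    rw [LinearMap.mem_ker, Matrix.mulVecLin_apply, Matrix.sub_mulVec,
      Matrix.smul_mulVec, Matrix.one_mulVec] at this
    exact sub_eq_zero.1 this
  have main : ∀ z : ℂ, cx J *ᵥ v.1 = z • v.1 → l = (1 - r) * μ.re + r * z.re ∧ 0 = (1 - r) * μ.im + r * z.im := by
    intro z hz
    rw [hcB, Matrix.add_mulVec, Matrix.smul_mulVec, Matrix.sub_mulVec, hAv, hz, ← sub_smul, smul_smul, ← add_smul] at hBv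
    have := smul_left_injective ℂ hv0 hBv
    have h1 := congrArg Complex.re this
    have h2 := congrArg Complex.im this
    simp at h1 h2
    constructor <;> linarith
  obtain ⟨hr0, hr1⟩ := hr
  rcases lt_or_gt_of_ne (not_real hA hv0 hAv) with h | h
  · have hz : cx J *ᵥ v.1 = (-Complex.I) • v.1 := by
      have := hker _ (by simpa using h) _ (star_mem_gen (eig_mem_gen hAv))
      have h2 := conj_mulVec (cx J) v.1
      rw [cx_conj, this] at h2
      rw [h2]; simp
    have := (main _ hz).2
    simp at this
    rcases eq_or_lt_of_le hr0 with h0 | h0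
    · subst h0; simp at this; linarith
    · nlinarith [mul_nonneg (sub_nonneg.2 hr1) (neg_pos.2 h).le]
  · have hz := hker _ h _ (eig_mem_gen hAv)
    have := (main _ hz).2
    simp at this
    rcases eq_or_lt_of_le hr0 with h0 | h0
    · subst h0; simp at this; linarith
    · nlinarith [mul_nonneg (sub_nonneg.2 hr1) h.le]

end LinAlg
end CCS

namespace CCS
section Final
variable {n : ℕ}

noncomputable def phi (n : ℕ) :
    Matrix (Fin n) (Fin n) ℝ ≃ₐ[ℝ] ((Fin n → ℝ) →L[ℝ] (Fin n → ℝ)) :=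
  Matrix.toLinAlgEquiv'.trans (Module.End.toContinuousLinearMap (Fin n → ℝ))

theorem isUnit_phi (M : Matrix (Fin n) (Fin n) ℝ) : IsUnit (phi n M) ↔ M.det ≠ 0 := by
  rw [MulEquiv.isUnit_map, Matrix.isUnit_iff_isUnit_det, isUnit_iff_ne_zero]

theorem K_phi (A : Matrix (Fin n) (Fin n) ℝ) (t : I) :
    K (phi n A) t = phi n ((Real.sin t.1 • 1 + (-Real.cos t.1) • A) * (Real.sin t.1 • 1 + Real.cos t.1 • A)) := by
  rw [K_apply, ← map_mul, ← map_one (phi n), ← map_smul, ← map_smul, ← map_sub]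
  congr 1
  simp only [mul_add, add_mul, smul_mul_assoc, mul_smul_comm, one_mul, mul_one, smul_smul]
  module

theorem det_comb {A : Matrix (Fin n) (Fin n) ℝ} (hA : NoReal A) {x y : ℝ} (h : x ^ 2 + y ^ 2 = 1) :
    (x • (1 : Matrix (Fin n) (Fin n) ℝ) + y • A).det ≠ 0 := by
  by_cases hy : y = 0
  · subst hy
    have hx : x ≠ 0 := by rintro rfl; simp at h
    simp [hx]
  · have : x • (1 : Matrix (Fin n) (Fin n) ℝ) + y • A = y • (A - (-x / y) • (1 : Matrix (Fin n) (Fin n) ℝ)) := by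
      rw [smul_sub, smul_smul, mul_div_cancel₀ _ hy]
      module
    rw [this, Matrix.det_smul]
    exact mul_ne_zero (pow_ne_zero _ hy) (hA _)

theorem noReal_iff (A : Matrix (Fin n) (Fin n) ℝ) : NoReal A ↔ IsUnit (K (phi n A)) := by
  rw [ContinuousMap.isUnit_iff_forall_isUnit]
  constructor
  · intro hA t
    rw [K_phi, isUnit_phi, Matrix.det_mul]
    exact mul_ne_zero (det_comb hA (by rw [neg_sq]; exact Real.sin_sq_add_cos_sq _))
      (det_comb hA (Real.sin_sq_add_cos_sq _))
  · intro h μ hμ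
    have h0 : 0 ≤ Real.arctan |μ| := Real.arctan_nonneg.2 (abs_nonneg μ)
    have h1 : Real.arctan |μ| ≤ Real.pi := by
      linarith [Real.arctan_lt_pi_div_two |μ|, Real.pi_pos]
    have hu := h ⟨Real.arctan |μ|, h0, h1⟩
    rw [K_phi, isUnit_phi] at hu
    apply hu
    have hc : Real.cos (Real.arctan |μ|) ≠ 0 := (Real.cos_arctan_pos _).ne'
    have hs : Real.sin (Real.arctan |μ|) = |μ| * Real.cos (Real.arctan |μ|) := by
      rw [← Real.tan_mul_cos hc, Real.tan_arctan]
    simp only [hs, Matrix.det_mul]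
    generalize Real.cos (Real.arctan |μ|) = c
    rcases abs_choice μ with e | e <;> rw [e]
    · have : (μ * c) • (1 : Matrix (Fin n) (Fin n) ℝ) + (-c) • A = (-c) • (A - μ • (1 : Matrix (Fin n) (Fin n) ℝ)) := by
        module
      rw [this, Matrix.det_smul, hμ]; simp
    · have : (-μ * c) • (1 : Matrix (Fin n) (Fin n) ℝ) + c • A = c • (A - μ • (1 : Matrix (Fin n) (Fin n) ℝ)) := by
        module
      rw [this, Matrix.det_smul, hμ]; simp

noncomputable def phiL (n : ℕ) : Matrix (Fin n) (Fin n) ℝ →L[ℝ] ((Fin n → ℝ) →L[ℝ] (Fin n → ℝ)) :=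
  LinearMap.toContinuousLinearMap (phi n).toLinearMap

noncomputable def psiL (n : ℕ) : ((Fin n → ℝ) →L[ℝ] (Fin n → ℝ)) →L[ℝ] Matrix (Fin n) (Fin n) ℝ :=
  LinearMap.toContinuousLinearMap (phi n).symm.toLinearMap

theorem phiL_apply (A : Matrix (Fin n) (Fin n) ℝ) : phiL n A = phi n A := rfl

theorem psiL_phi (A : Matrix (Fin n) (Fin n) ℝ) : psiL n (phi n A) = A :=
  (phi n).symm_apply_apply A

theorem unique_J {A J : Matrix (Fin n) (Fin n) ℝ} (hA : NoReal A) (hJ2 : J * J = -1)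
    (hJA : J * A = A * J)
    (hJ : ∀ μ : ℂ, 0 < μ.im → gen A μ ≤ LinearMap.ker (Matrix.mulVecLin (cx J - Complex.I • 1))) :
    J = psiL n (G (phiL n A)) := by
  have h1 : G (phi n A) = G (phi n A + phi n (J - A)) := by
    apply G_const
    · rw [← map_mul, ← map_mul, mul_sub, sub_mul, hJA]
    · intro r hr
      rw [← map_smul, ← map_add, ← noReal_iff]
      exact path_noReal hA hJA hJ hr
  rw [← map_add, add_sub_cancel, G_fix (j := phi n J) (by rw [← map_mul, hJ2, map_neg, map_one])] at h1
  rw [phiL_apply, h1, psiL_phi]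

end Final
end CCS

/-- the set of real matrices without real eigenvalues is open, and
on it the canonical complex structure `A ↦ J(A)` is a well-defined real-analytic
map;  `J(A)` is characterized by `J² = -I`, `JA = AJ`, and the condition that for
every `μ` with positive imaginary part the generalized `μ`-eigenspace of `A`
(over ℂ) is contained in the `i`-eigenspace of `J` (over ℂ). -/
theorem canonical_complex_structure_analytic (n : ℕ) :
    let W : Set (Matrix (Fin n) (Fin n) ℝ) :=
      {A | ∀ μ : ℝ, (A - μ • (1 : Matrix (Fin n) (Fin n) ℝ)).det ≠ 0}
    let IsCanonicalJ : Matrix (Fin n) (Fin n) ℝ → Matrix (Fin n) (Fin n) ℝ → Prop :=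
      fun A J =>
        J * J = -1 ∧ J * A = A * J ∧
        ∀ μ : ℂ, 0 < μ.im →
          LinearMap.ker
            (Matrix.mulVecLin ((A.map (algebraMap ℝ ℂ) - μ • 1) ^ n))
            ≤ LinearMap.ker
              (Matrix.mulVecLin ((J.map (algebraMap ℝ ℂ)) - Complex.I • 1))
    IsOpen W ∧
    ∃ F : Matrix (Fin n) (Fin n) ℝ → Matrix (Fin n) (Fin n) ℝ,
      AnalyticOnNhd ℝ F W ∧
      ∀ A ∈ W, IsCanonicalJ A (F A) ∧
        ∀ J : Matrix (Fin n) (Fin n) ℝ, IsCanonicalJ A J → J = F A := by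
  intro W IsCanonicalJ
  have hW : W = (CCS.phiL n) ⁻¹' {a | IsUnit (CCS.K a)} := by
    ext A
    exact CCS.noReal_iff A
  refine ⟨?_, fun A => CCS.psiL n (CCS.G (CCS.phiL n A)), ?_, ?_⟩
  · rw [hW]
    exact CCS.isOpen_unit.preimage (CCS.phiL n).continuous
  · intro A hA
    rw [hW] at hA
    have h1 : AnalyticAt ℝ (fun A => CCS.G (CCS.phiL n A)) A :=
      (CCS.analytic_G hA).comp ((CCS.phiL n).analyticAt A)
    exact ((CCS.psiL n).analyticAt _).comp h1
  · intro A hA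
    have hu : ∀ J, IsCanonicalJ A J → J = CCS.psiL n (CCS.G (CCS.phiL n A)) :=
      fun J hJ => CCS.unique_J hA hJ.1 hJ.2.1 hJ.2.2
    obtain ⟨J, hJ⟩ := CCS.exists_J hA
    refine ⟨?_, hu⟩
    have := hu J hJ
    show IsCanonicalJ A (CCS.psiL n (CCS.G (CCS.phiL n A)))
    rw [← this]
    exact hJ
end
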